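/- Let 𝔸₁ denote the set of positive integers all of whose prime divisors are congruent to 1 modulo 4, ω(n) the number of distinct prime divisors of n, and r(ℓ) the number of pairs (m₁,m₂) ∈ ℤ² with m₁² + m₂² = ℓ. Fix constants 0 < a < b and β > 0. Then there exist c > 0 and Λ₀ such that for all real Λ ≥ Λ₀, with K = ⌊β log log Λ⌋, Σ_{ℓ : aΛ² ≤ ℓ ≤ bΛ², ℓ ∈ 𝔸₁, ω(ℓ) = K} r(ℓ) ≥ c · (Λ²/√(log log Λ)) · (log Λ)^{β − 1 − β log β}. -/

import Mathlib

open Real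

/-- The set of positive integers all of whose prime divisors are ≡ 1 (mod 4). -/
def A1 : Set ℕ := {n : ℕ | 0 < n ∧ ∀ p : ℕ, p.Prime → p ∣ n → p % 4 = 1}

/-- `rTwoSquares ℓ` is the number of representations of `ℓ` as an ordered sum
of two squares of integers (signs and order counted). -/
noncomputable def rTwoSquares (ℓ : ℕ) : ℕ :=
  Set.ncard {p : ℤ × ℤ | p.1 ^ 2 + p.2 ^ 2 = (ℓ : ℤ)}

section
open Finset
open ArithmeticFunction hiding log

/-- The nontrivial Dirichlet character modulo 4 on natural numbers, with real values. -/
noncomputable def chiFour (n : ℕ) : ℝ := ((ZMod.χ₄ (n : ZMod 4) : ℤ) : ℝ)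

lemma chiFour_mul (m n : ℕ) : chiFour (m * n) = chiFour m * chiFour n := by
  rw [chiFour, chiFour, chiFour, ← Int.cast_mul, ← map_mul, Nat.cast_mul]

lemma chiFour_eq_ite (n : ℕ) :
    chiFour n = if n % 2 = 0 then 0 else if n % 4 = 1 then 1 else -1 := by
  rw [chiFour, ZMod.χ₄_nat_eq_if_mod_four]
  split_ifs <;> simp

lemma abs_chiFour_le_one (n : ℕ) : |chiFour n| ≤ 1 := by
  rw [chiFour_eq_ite]
  split_ifs <;> simp

lemma sum_range_chiFour (n : ℕ) :
    ∑ k ∈ range n, chiFour k = if n % 4 = 2 ∨ n % 4 = 3 then 1 else 0 := by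
  induction n with
  | zero => simp
  | succ n ih =>
    rw [sum_range_succ, ih, chiFour_eq_ite]
    have h : n % 4 < 4 := Nat.mod_lt _ (by norm_num)
    have h2 : n % 2 = (n % 4) % 2 := by omega
    have h1 : (n + 1) % 4 = (n % 4 + 1) % 4 := by omega
    rw [h1, h2]
    interval_cases n % 4 <;> norm_num

lemma abs_sum_Ico_chiFour_mul_le {f : ℕ → ℝ} {a b : ℕ} (hab : a ≤ b)
    (hf : ∀ n, a ≤ n → f (n + 1) ≤ f n) (hf0 : ∀ n, a ≤ n → 0 ≤ f n) :
    |∑ n ∈ Ico a b, chiFour n * f n| ≤ f a := by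
  have hX (n : ℕ) : 0 ≤ ∑ k ∈ range n, chiFour k ∧ ∑ k ∈ range n, chiFour k ≤ 1 := by
    rw [sum_range_chiFour]
    split_ifs <;> simp
  have key : -f a ≤ ∑ n ∈ Ico a b, chiFour n * f n - (∑ k ∈ range b, chiFour k) * f b ∧
      ∑ n ∈ Ico a b, chiFour n * f n - (∑ k ∈ range b, chiFour k) * f b ≤ f a - f b := by
    induction b, hab using Nat.le_induction with
    | base =>
      have := hX a
      have := hf0 a le_rfl
      simp only [Ico_self, sum_empty]
      constructor <;> nlinarith
    | succ b hab ih =>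
      rw [sum_Ico_succ_top hab]
      have h1 := sum_range_succ chiFour b
      have h2 := hX (b + 1)
      have h3 := hf b hab
      have h4 : chiFour b = ∑ k ∈ range (b + 1), chiFour k - ∑ k ∈ range b, chiFour k := by
        linarith
      generalize ∑ k ∈ range (b + 1), chiFour k = u at *
      generalize ∑ k ∈ range b, chiFour k = v at *
      rw [h4]
      constructor <;> nlinarith
  have h1 := hX b
  have h2 := hf0 b hab
  rw [abs_le]
  constructor <;> nlinarith

lemma abs_sum_Ico_chiFour_div_le {a b : ℕ} (ha : 0 < a) (hab : a ≤ b) :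
    |∑ n ∈ Ico a b, chiFour n / n| ≤ 1 / a := by
  have := abs_sum_Ico_chiFour_mul_le (f := fun n : ℕ ↦ 1 / (n : ℝ)) hab
    (fun n hn ↦ by
      have : (0 : ℝ) < n := by exact_mod_cast ha.trans_le hn
      gcongr; simp) (fun n hn ↦ by positivity)
  simpa [div_eq_mul_inv] using this

lemma two_thirds_le_sum_chiFour_div {N : ℕ} (hN : 1 ≤ N) :
    2 / 3 ≤ ∑ n ∈ Ioc 0 N, chiFour n / n := by
  have h1 : Ioc 0 N = Ico 1 (N + 1) := by ext; simp; omega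
  rw [h1]
  rcases hN.eq_or_lt with rfl | h
  · simp [chiFour_eq_ite]; norm_num
  · rw [← sum_Ico_consecutive _ (show 1 ≤ 3 by norm_num) (show 3 ≤ N + 1 by omega)]
    have := abs_sum_Ico_chiFour_div_le (a := 3) (b := N + 1) (by norm_num) (by omega)
    have h2 : ∑ n ∈ Ico 1 3, chiFour n / n = 1 := by
      simp [sum_Ico_succ_top, chiFour_eq_ite]
    rw [h2]
    have := (abs_le.1 this).1
    norm_num at this
    linarith

lemma abs_sum_chiFour_mul_log_div_le : ∃ C : ℝ, ∀ N : ℕ,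
    |∑ n ∈ Ioc 0 N, chiFour n * (log n / n)| ≤ C := by
  refine ⟨|∑ n ∈ Ico 1 3, chiFour n * (log n / n)| + log 3 / 3, fun N ↦ ?_⟩
  have h1 : Ioc 0 N = Ico 1 (N + 1) := by ext; simp; omega
  rw [h1]
  have h0 : (0 : ℝ) ≤ log 3 / 3 := by positivity
  by_cases h : N < 2
  · interval_cases N <;> simp <;> positivity
  · rw [← sum_Ico_consecutive _ (show 1 ≤ 3 by norm_num) (show 3 ≤ N + 1 by omega)]
    refine (abs_add_le _ _).trans ?_
    gcongr
    have := abs_sum_Ico_chiFour_mul_le (f := fun n : ℕ ↦ log n / (n : ℝ))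
      (show 3 ≤ N + 1 by omega)
      (fun n hn ↦ by
        have h3 : (3 : ℝ) ≤ n := by exact_mod_cast hn
        have h4 := exp_one_lt_d9
        exact log_div_self_antitoneOn (Set.mem_Ici.2 (by linarith))
          (Set.mem_Ici.2 (by push_cast; linarith)) (by simp)) (fun n hn ↦ by positivity)
    simpa using this

lemma abs_sum_chiFour_mul_vonMangoldt_div_le : ∃ C : ℝ, ∀ N : ℕ,
    |∑ n ∈ Ioc 0 N, chiFour n * vonMangoldt n / n| ≤ C := by
  obtain ⟨C, hC⟩ := abs_sum_chiFour_mul_log_div_le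
  refine ⟨3 / 2 * (C + (log 4 + 4)), fun N ↦ ?_⟩
  rcases Nat.eq_zero_or_pos N with rfl | hN
  · have := (abs_nonneg _).trans (hC 0)
    simp; positivity
  have hN' : (0 : ℝ) < N := by exact_mod_cast hN
  let f : ArithmeticFunction ℝ := ⟨fun n ↦ chiFour n * vonMangoldt n / n, by simp⟩
  let g : ArithmeticFunction ℝ := ⟨fun n ↦ chiFour n / n, by simp⟩
  have hfg (n : ℕ) : (f * g) n = chiFour n * (log n / n) := by
    rw [ArithmeticFunction.mul_apply, ← vonMangoldt_sum,
      ← Nat.sum_divisorsAntidiagonal (fun i _ ↦ vonMangoldt i), sum_div, mul_sum]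
    refine sum_congr rfl fun x hx ↦ ?_
    have := (Nat.mem_divisorsAntidiagonal.1 hx).1
    simp only [f, g, ArithmeticFunction.coe_mk]
    rw [← this, chiFour_mul]
    push_cast
    field_simp
  have h1 := sum_Ioc_mul_eq_sum_sum f g N
  simp only [hfg] at h1
  simp only [f, g, ArithmeticFunction.coe_mk] at h1
  set S := ∑ n ∈ Ioc 0 N, chiFour n / n with hS
  set T := ∑ n ∈ Ioc 0 N, chiFour n * vonMangoldt n / n with hT
  have h2 : |S * T - ∑ n ∈ Ioc 0 N, chiFour n * (log n / n)| ≤ log 4 + 4 := by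
    rw [h1, hT, mul_sum, ← sum_sub_distrib]
    calc |_| ≤ ∑ n ∈ Ioc 0 N, |_| := abs_sum_le_sum_abs _ _
      _ ≤ ∑ n ∈ Ioc 0 N, vonMangoldt n / N := by
        refine sum_le_sum fun n hn ↦ ?_
        have hn0 : 0 < n := (mem_Ioc.1 hn).1
        have hn0' : (0 : ℝ) < n := by exact_mod_cast hn0
        have e : S = ∑ m ∈ Ioc 0 (N / n), chiFour m / m +
            ∑ m ∈ Ico (N / n + 1) (N + 1), chiFour m / m := by
          have h3 (k : ℕ) : Ioc 0 k = Ico 1 (k + 1) := by ext; simp; omega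
          rw [hS, h3, h3, sum_Ico_consecutive _ (Nat.le_add_left _ _)
            (Nat.succ_le_succ (Nat.div_le_self N n))]
        have hd : |∑ m ∈ Ico (N / n + 1) (N + 1), chiFour m / m| ≤ n / N := by
          refine (abs_sum_Ico_chiFour_div_le (Nat.succ_pos _)
            (Nat.succ_le_succ (Nat.div_le_self N n))).trans ?_
          rw [div_le_div_iff₀ (by positivity) hN', one_mul]
          have := Nat.lt_mul_div_succ N hn0
          exact_mod_cast this.le
        have e2 : S * (chiFour n * vonMangoldt n / n) - chiFour n * vonMangoldt n / n *
            ∑ m ∈ Ioc 0 (N / n), chiFour m / m = chiFour n * (vonMangoldt n / n *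
              ∑ m ∈ Ico (N / n + 1) (N + 1), chiFour m / m) := by rw [e]; ring
        rw [e2, abs_mul, abs_mul, abs_of_nonneg (a := vonMangoldt n / n)
          (div_nonneg vonMangoldt_nonneg hn0'.le)]
        calc _ ≤ 1 * (vonMangoldt n / n * (n / N)) := by
              gcongr
              · exact abs_chiFour_le_one n
          _ = _ := by field_simp
      _ ≤ log 4 + 4 := by
        rw [← sum_div, div_le_iff₀ hN']
        have := Chebyshev.psi_le_const_mul_self (x := N) hN'.le
        rwa [Chebyshev.psi, Nat.floor_natCast] at this
  have h3 : 2 / 3 ≤ S := two_thirds_le_sum_chiFour_div hN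
  have h4 : |S * T| ≤ C + (log 4 + 4) := by
    have := abs_le.1 h2
    have := abs_le.1 (hC N)
    rw [abs_le]
    constructor <;> linarith
  rw [abs_mul, abs_of_nonneg (by linarith)] at h4
  nlinarith [abs_nonneg T]

lemma abs_sum_vonMangoldt_div_sub_log_le : ∃ C : ℝ, ∀ N : ℕ, 0 < N →
    |∑ n ∈ Ioc 0 N, vonMangoldt n / n - log N| ≤ C := by
  refine ⟨log 4 + 4, fun N hN ↦ ?_⟩
  have hN' : (0 : ℝ) < N := by exact_mod_cast hN
  have h1 := sum_Ioc_mul_zeta_eq_sum vonMangoldt N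
  rw [vonMangoldt_mul_zeta] at h1
  simp only [log_apply] at h1
  have hfac (M : ℕ) : ∑ n ∈ Ioc 0 M, Real.log n = Real.log M.factorial := by
    induction M with
    | zero => simp
    | succ M ih =>
      rw [sum_Ioc_succ_top M.zero_le, ih, Nat.factorial_succ, Nat.cast_mul,
        log_mul (by positivity) (by positivity), add_comm]
  rw [hfac] at h1
  have hup : Real.log N.factorial ≤ N * Real.log N := by
    rw [← Real.log_pow]
    exact Real.log_le_log (by positivity) (by exact_mod_cast Nat.factorial_le_pow N)
  have hlow : N * Real.log N - N ≤ Real.log N.factorial := by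
    have := Stirling.le_log_factorial_stirling (n := N) hN.ne'
    have h5 : 0 ≤ log N := log_natCast_nonneg N
    have h6 : 0 ≤ log (2 * π) := log_nonneg (by linarith [pi_gt_three])
    linarith
  have hpsi := Chebyshev.psi_le_const_mul_self (x := N) hN'.le
  rw [Chebyshev.psi, Nat.floor_natCast] at hpsi
  set T := ∑ n ∈ Ioc 0 N, vonMangoldt n / n with hT
  have hge : Real.log N.factorial ≤ N * T := by
    rw [h1, hT, mul_sum]
    refine sum_le_sum fun n hn ↦ ?_
    have : ((N / n : ℕ) : ℝ) ≤ N / n := Nat.cast_div_le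
    calc _ ≤ vonMangoldt n * (N / n) := by gcongr
      _ = _ := by ring
  have hle : N * T ≤ Real.log N.factorial + ∑ n ∈ Ioc 0 N, vonMangoldt n := by
    rw [h1, hT, mul_sum, ← sum_add_distrib]
    refine sum_le_sum fun n hn ↦ ?_
    have hn0 : 0 < n := (mem_Ioc.1 hn).1
    have hn0' : (0 : ℝ) < n := by exact_mod_cast hn0
    have : (N : ℝ) / n ≤ (N / n : ℕ) + 1 := by
      rw [div_le_iff₀ hn0', mul_comm]
      exact_mod_cast (Nat.lt_mul_div_succ N hn0).le
    calc _ = vonMangoldt n * (N / n) := by ring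
      _ ≤ vonMangoldt n * ((N / n : ℕ) + 1) := by gcongr
      _ = _ := by ring
  have h4 : 0 ≤ Real.log 4 := by positivity
  rw [abs_le]
  constructor
  · have : N * (T - Real.log N) ≥ N * (-1) := by linarith
    have := le_of_mul_le_mul_left this hN'
    linarith
  · have : N * (T - Real.log N) ≤ N * (Real.log 4 + 4) := by linarith
    exact le_of_mul_le_mul_left this hN'

lemma sum_div_le_of_sum_le_sqrt {g : ℕ → ℝ} {C : ℝ} (hg : ∀ N : ℕ, ∑ n ∈ Ioc 0 N, g n ≤ C * √N)
    (hC : 0 ≤ C) (N : ℕ) : ∑ n ∈ Ioc 0 N, g n / n ≤ 3 * C := by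
  rcases Nat.eq_zero_or_pos N with rfl | hN
  · simpa
  have key : ∑ n ∈ Ioc 0 N, g n / n ≤ (∑ n ∈ Ioc 0 N, g n) / N + 2 * C * (1 - 1 / √N) := by
    induction N, hN using Nat.le_induction with
    | base => simp
    | succ N hN ih =>
      rw [sum_Ioc_succ_top N.zero_le, sum_Ioc_succ_top N.zero_le]
      have h0 := hg N
      have hN0 : (0 : ℝ) < N := by exact_mod_cast hN
      push_cast at *
      set G := ∑ n ∈ Ioc 0 N, g n
      have e1 : G / N = G / (N + 1) + G / (N * (N + 1)) := by field_simp
      have e2 : G / (N * (N + 1)) ≤ 2 * C * (1 / √N - 1 / √(N + 1)) := by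
        have hs : 0 < √(N : ℝ) := by positivity
        have ht : 0 < √(N + 1 : ℝ) := by positivity
        have hs2 : √(N : ℝ) ^ 2 = N := sq_sqrt hN0.le
        have ht2 : √(N + 1 : ℝ) ^ 2 = N + 1 := sq_sqrt (by positivity)
        have hst : √(N : ℝ) ≤ √(N + 1 : ℝ) := sqrt_le_sqrt (by linarith)
        calc G / (N * (N + 1)) ≤ C * √N / (N * (N + 1)) := by gcongr
          _ = C * (1 / (√N * √(N + 1) ^ 2)) := by
            rw [ht2]; nth_rw 2 [← hs2]; field_simp
          _ ≤ C * (2 * (1 / √N - 1 / √(N + 1))) := by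
            gcongr
            have : 1 / √(N : ℝ) - 1 / √(N + 1 : ℝ) =
                1 / (√N * √(N + 1) * (√N + √(N + 1))) := by
              have : (√(N + 1 : ℝ) - √N) * (√N + √(N + 1)) = 1 := by nlinarith
              field_simp
              linarith
            rw [this, ← div_eq_mul_one_div, div_le_div_iff₀ (by positivity) (by positivity)]
            nlinarith [mul_pos hs ht]
          _ = _ := by ring
      rw [add_div]
      linarith
  have h1 := hg N
  have hN0 : (1 : ℝ) ≤ N := by exact_mod_cast hN
  have h2 : (∑ n ∈ Ioc 0 N, g n) / N ≤ C := by
    rw [div_le_iff₀ (by linarith)]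
    refine h1.trans ?_
    gcongr
    exact sqrt_le_iff.2 ⟨by positivity, by nlinarith⟩
  have h3 : 0 ≤ 1 / √(N : ℝ) := by positivity
  nlinarith

lemma sum_vonMangoldt_div_not_prime_le : ∃ C : ℝ, ∀ N : ℕ,
    ∑ n ∈ Ioc 0 N with ¬ n.Prime, vonMangoldt n / n ≤ C := by
  obtain ⟨C, hC⟩ := Chebyshev.psi_sub_theta_le_mul_sqrt
  have h1 (N : ℕ) : ∑ n ∈ Ioc 0 N, (if ¬ n.Prime then vonMangoldt n else 0) ≤ |C| * √N := by
    have := hC N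
    rw [Chebyshev.psi_sub_theta_eq_sum_not_prime, Nat.floor_natCast, sum_filter] at this
    refine this.trans ?_
    gcongr
    exact le_abs_self C
  refine ⟨3 * |C|, fun N ↦ ?_⟩
  refine le_trans (le_of_eq ?_) (sum_div_le_of_sum_le_sqrt h1 (abs_nonneg C) N)
  rw [sum_filter]
  refine sum_congr rfl fun n hn ↦ ?_
  split_ifs <;> simp

lemma abs_log_floor_sub_log_le {x : ℝ} (hx : 1 ≤ x) : |log ⌊x⌋₊ - log x| ≤ log 2 := by
  have h1 : (1 : ℝ) ≤ ⌊x⌋₊ := by exact_mod_cast (Nat.one_le_floor_iff x).2 hx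
  have h2 : (⌊x⌋₊ : ℝ) ≤ x := Nat.floor_le (by linarith)
  have h3 : x ≤ 2 * ⌊x⌋₊ := by linarith [Nat.lt_floor_add_one x]
  have h4 : log ⌊x⌋₊ ≤ log x := log_le_log (by linarith) h2
  have h5 : log x ≤ log 2 + log ⌊x⌋₊ := by
    rw [← log_mul (by norm_num) (by linarith)]
    exact log_le_log (by linarith) h3
  rw [abs_le]
  constructor <;> linarith [log_pos (show (1 : ℝ) < 2 by norm_num)]

lemma sum_prime_log_div_le : ∃ C : ℝ, 0 ≤ C ∧ ∀ x : ℝ, 1 ≤ x →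
    ∑ p ∈ Ioc 0 ⌊x⌋₊ with p.Prime, log p / p ≤ log x + C := by
  obtain ⟨C, hC⟩ := abs_sum_vonMangoldt_div_sub_log_le
  refine ⟨|C| + log 2, by positivity, fun x hx ↦ ?_⟩
  have hx1 : 0 < ⌊x⌋₊ := (Nat.one_le_floor_iff x).2 hx
  have h1 := (abs_le.1 (hC _ hx1)).2
  have h2 := (abs_le.1 (abs_log_floor_sub_log_le hx)).2
  have h3 : ∑ p ∈ Ioc 0 ⌊x⌋₊ with p.Prime, log p / p ≤
      ∑ n ∈ Ioc 0 ⌊x⌋₊, vonMangoldt n / n := by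
    rw [sum_filter]
    refine sum_le_sum fun n hn ↦ ?_
    split_ifs with h
    · rw [vonMangoldt_apply_prime h]
    · exact div_nonneg vonMangoldt_nonneg (by positivity)
  have h4 := (Nat.floor_le (show 0 ≤ x by linarith))
  have h5 : log ⌊x⌋₊ ≤ log x := log_le_log (by exact_mod_cast hx1) h4
  have := le_abs_self C
  have : 0 ≤ log 2 := by positivity
  linarith

lemma abs_sum_prime_one_mod_four_sub_half_log_le : ∃ C : ℝ, 0 ≤ C ∧ ∀ x : ℝ, 1 ≤ x →
    |∑ p ∈ Ioc 0 ⌊x⌋₊ with p.Prime ∧ p % 4 = 1, log p / p - log x / 2| ≤ C := by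
  obtain ⟨C₁, hC₁⟩ := abs_sum_vonMangoldt_div_sub_log_le
  obtain ⟨C₂, hC₂⟩ := abs_sum_chiFour_mul_vonMangoldt_div_le
  obtain ⟨C₃, hC₃⟩ := sum_vonMangoldt_div_not_prime_le
  have key (x : ℝ) (hx : 1 ≤ x) :
    |∑ p ∈ Ioc 0 ⌊x⌋₊ with p.Prime ∧ p % 4 = 1, log p / p - log x / 2| ≤
      (C₁ + C₂ + log 2) / 2 + C₃ + log 2 := by
    have hx1 : 0 < ⌊x⌋₊ := (Nat.one_le_floor_iff x).2 hx
    have h1 := hC₁ _ hx1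
    have h2 := hC₂ ⌊x⌋₊
    have h3 := hC₃ ⌊x⌋₊
    have h4 := abs_log_floor_sub_log_le hx
    set N := ⌊x⌋₊
    have h5 : |∑ p ∈ Ioc 0 N with p.Prime ∧ p % 4 = 1, log p / p -
        (∑ n ∈ Ioc 0 N, vonMangoldt n / n + ∑ n ∈ Ioc 0 N, chiFour n * vonMangoldt n / n) / 2| ≤
        ∑ n ∈ Ioc 0 N with ¬ n.Prime, vonMangoldt n / n + log 2 / 2 := by
      have h6 : ∑ n ∈ Ioc 0 N, (if n = 2 then log 2 / 2 else 0) ≤ log 2 / 2 := by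
        rw [sum_ite_eq']
        split_ifs
        · rfl
        · positivity
      rw [sum_filter, sum_filter, ← sum_add_distrib, sum_div, ← sum_sub_distrib]
      refine (abs_sum_le_sum_abs _ _).trans (le_trans ?_ (add_le_add_right h6 _))
      rw [← sum_add_distrib]
      refine sum_le_sum fun n hn ↦ ?_
      have hL : 0 ≤ vonMangoldt n / n := div_nonneg vonMangoldt_nonneg (by positivity)
      by_cases hp : n.Prime
      · rw [vonMangoldt_apply_prime hp, chiFour_eq_ite]
        rcases hp.eq_two_or_odd with rfl | hodd
        · have : 0 ≤ log 2 / 2 := by positivity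
          norm_num [abs_of_nonneg]
          rw [abs_of_nonneg] <;> linarith
        · have : n ≠ 2 := by rintro rfl; omega
          by_cases h4 : n % 4 = 1
          · simp only [h4, hodd, this, hp]
            norm_num
          · simp only [h4, hodd, this, hp]
            norm_num
            ring
      · simp only [hp, false_and, if_false, not_false_eq_true, if_true]
        have e : (0 : ℝ) - (vonMangoldt n / n + chiFour n * vonMangoldt n / n) / 2 =
          -((1 + chiFour n) / 2 * (vonMangoldt n / n)) := by ring
        have hc := abs_le.1 (abs_chiFour_le_one n)
        rw [e, abs_neg, abs_of_nonneg (mul_nonneg (by linarith) hL)]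
        have : (0 : ℝ) ≤ if n = 2 then log 2 / 2 else 0 := by split_ifs <;> positivity
        nlinarith
    rw [abs_le] at *
    constructor <;> linarith
  refine ⟨_, (abs_nonneg _).trans (key 1 le_rfl), key⟩

end

section
open Finset

/-- The primes `p ≡ 1 (mod 4)` with `p ≤ x`. -/
noncomputable def primesOneModFour (x : ℝ) : Finset ℕ :=
  {p ∈ Ioc 0 ⌊x⌋₊ | p.Prime ∧ p % 4 = 1}

lemma mem_primesOneModFour {x : ℝ} {p : ℕ} :
    p ∈ primesOneModFour x ↔ p.Prime ∧ p % 4 = 1 ∧ (p : ℝ) ≤ x := by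
  rw [primesOneModFour, mem_filter, mem_Ioc]
  constructor
  · rintro ⟨⟨h1, h2⟩, h3, h4⟩
    exact ⟨h3, h4, (Nat.le_floor_iff' h1.ne').1 h2⟩
  · rintro ⟨h3, h4, h5⟩
    exact ⟨⟨h3.pos, Nat.le_floor h5⟩, h3, h4⟩

lemma primesOneModFour_mono {x y : ℝ} (h : x ≤ y) : primesOneModFour x ⊆ primesOneModFour y := by
  intro p
  simp only [mem_primesOneModFour]
  exact fun ⟨h1, h2, h3⟩ ↦ ⟨h1, h2, h3.trans h⟩

lemma abs_sum_primesOneModFour_sub_half_log_le : ∃ C : ℝ, 0 ≤ C ∧ ∀ x : ℝ, 1 ≤ x →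
    |∑ p ∈ primesOneModFour x, log p / p - log x / 2| ≤ C :=
  abs_sum_prime_one_mod_four_sub_half_log_le

lemma div_log_le_card_primesOneModFour_sdiff : ∃ B : ℝ, 1 < B ∧ ∀ Y : ℝ, 1 ≤ Y →
    Y / log (B * Y) ≤ #(primesOneModFour (B * Y) \ primesOneModFour Y) := by
  obtain ⟨C, hC0, hC⟩ := abs_sum_primesOneModFour_sub_half_log_le
  refine ⟨exp (4 * C + 2), by simpa using by linarith, fun Y hY ↦ ?_⟩
  set B := exp (4 * C + 2) with hB
  have hB1 : 1 < B := by rw [hB]; simpa using by linarith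
  have hBY : Y < B * Y := by nlinarith
  have hlog : log (B * Y) = 4 * C + 2 + log Y := by
    rw [log_mul (by linarith) (by linarith), hB, log_exp]
  have h0 : 0 < log (B * Y) := log_pos (by linarith)
  have h1 := (abs_le.1 (hC (B * Y) (by linarith))).1
  have h2 := (abs_le.1 (hC Y hY)).2
  have h3 := sum_sdiff (f := fun p : ℕ ↦ log p / (p : ℝ)) (primesOneModFour_mono hBY.le)
  have h4 : ∑ p ∈ primesOneModFour (B * Y) \ primesOneModFour Y, log p / p ≤
      #(primesOneModFour (B * Y) \ primesOneModFour Y) • (log (B * Y) / Y) := by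
    refine sum_le_card_nsmul _ _ _ fun p hp ↦ ?_
    simp only [mem_sdiff, mem_primesOneModFour, not_and, not_le] at hp
    have hp1 := hp.2 hp.1.1 hp.1.2.1
    have : (0 : ℝ) < p := by exact_mod_cast hp.1.1.pos
    gcongr
    exact hp.1.2.2
  rw [nsmul_eq_mul, mul_div_assoc'] at h4
  rw [div_le_iff₀ h0]
  have h5 : 1 ≤ #(primesOneModFour (B * Y) \ primesOneModFour Y) * log (B * Y) / Y := by linarith
  rwa [le_div_iff₀ (by linarith), one_mul] at h5

lemma half_log_log_sub_le_sum_inv : ∃ C : ℝ, ∀ x : ℝ, exp 1 ≤ x →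
    log (log x) / 2 - C ≤ ∑ p ∈ primesOneModFour x, 1 / (p : ℝ) := by
  obtain ⟨C, hC0, hC⟩ := abs_sum_primesOneModFour_sub_half_log_le
  have key (n : ℕ) (hn : 1 ≤ n) :
      (∑ p ∈ primesOneModFour (exp n), log p / p) / n + log n / 2 - (C + 1 / 2) * (1 - 1 / n) ≤
        ∑ p ∈ primesOneModFour (exp n), 1 / (p : ℝ) := by
    induction n, hn using Nat.le_induction with
    | base =>
      simp only [Nat.cast_one, div_one, log_one, zero_div, add_zero, sub_self, mul_zero, sub_zero]
      refine sum_le_sum fun p hp ↦ ?_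
      rw [mem_primesOneModFour] at hp
      have : (0 : ℝ) < p := by exact_mod_cast hp.1.pos
      gcongr
      exact (log_le_iff_le_exp this).2 hp.2.2
    | succ n hn ih =>
      have hn0 : (1 : ℝ) ≤ n := by exact_mod_cast hn
      have hsub : primesOneModFour (exp n) ⊆ primesOneModFour (exp (n + 1 : ℕ)) :=
        primesOneModFour_mono (exp_le_exp.2 (by simp))
      have h1 := sum_sdiff (f := fun p : ℕ ↦ log p / (p : ℝ)) hsub
      have h2 := sum_sdiff (f := fun p : ℕ ↦ 1 / (p : ℝ)) hsub
      have h3 : (∑ p ∈ primesOneModFour (exp (n + 1 : ℕ)) \ primesOneModFour (exp n),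
          log p / p) / (n + 1) ≤
          ∑ p ∈ primesOneModFour (exp (n + 1 : ℕ)) \ primesOneModFour (exp n), 1 / (p : ℝ) := by
        rw [sum_div]
        refine sum_le_sum fun p hp ↦ ?_
        have hp := mem_primesOneModFour.1 (mem_sdiff.1 hp).1
        have : (0 : ℝ) < p := by exact_mod_cast hp.1.pos
        rw [div_right_comm]
        gcongr
        rw [div_le_one (by positivity)]
        have := (log_le_iff_le_exp this).2 hp.2.2
        exact_mod_cast this
      have h4 := (abs_le.1 (hC (exp n) (by simp))).1
      rw [log_exp] at h4
      set a := ∑ p ∈ primesOneModFour (exp n), log p / p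
      set a' := ∑ p ∈ primesOneModFour (exp (n + 1 : ℕ)), log p / p
      have h5 : log (n + 1) ≤ log n + 1 / n := by
        have : log ((n + 1 : ℝ) / n) ≤ (n + 1 : ℝ) / n - 1 := log_le_sub_one_of_pos (by positivity)
        rw [log_div (by positivity) (by positivity)] at this
        have e : (n + 1 : ℝ) / n - 1 = 1 / n := by field_simp; ring
        linarith
      have e1 : a / n = a / (n + 1) + a / (n * (n + 1)) := by field_simp
      have e2 : (n / 2 - C) / (n * (n + 1)) ≤ a / (n * (n + 1)) := by gcongr; linarith
      have e3 : (n / 2 - C) / (n * (n + 1)) =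
        1 / n / 2 - (C + 1 / 2) * (1 / n - 1 / (n + 1)) := by field_simp; ring
      have e4 : (a' - a) / (n + 1) = a' / (n + 1) - a / (n + 1) := sub_div _ _ _
      rw [show ∑ p ∈ primesOneModFour (exp (n + 1 : ℕ)) \ primesOneModFour (exp n),
          log p / p = a' - a by linarith] at h3
      push_cast at *
      linarith
  refine ⟨2 * C + 1 / 2 + log 2 / 2, fun x hx ↦ ?_⟩
  have hx0 : 0 < x := (exp_pos 1).trans_le hx
  have h1 : 1 ≤ log x := (le_log_iff_exp_le hx0).2 hx
  have hn : 1 ≤ ⌊log x⌋₊ := (Nat.one_le_floor_iff _).2 h1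
  have h2 := key _ hn
  have h3 := (abs_le.1 (abs_log_floor_sub_log_le h1)).1
  have h4 : (⌊log x⌋₊ : ℝ) ≤ log x := Nat.floor_le (by linarith)
  set n := ⌊log x⌋₊
  have hn0 : (1 : ℝ) ≤ n := by exact_mod_cast hn
  have h5 := (abs_le.1 (hC (exp n) (by simp))).1
  rw [log_exp] at h5
  have h6 : ∑ p ∈ primesOneModFour (exp n), 1 / (p : ℝ) ≤
      ∑ p ∈ primesOneModFour x, 1 / (p : ℝ) :=
    sum_le_sum_of_subset_of_nonneg
      (primesOneModFour_mono ((exp_le_exp.2 h4).trans_eq (exp_log hx0)))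
      fun _ _ _ ↦ by positivity
  have h7 : -C ≤ (∑ p ∈ primesOneModFour (exp n), log p / p) / n := by
    rw [le_div_iff₀ (by linarith)]
    nlinarith
  have h8 : 0 ≤ 1 / (n : ℝ) := by positivity
  nlinarith

lemma sum_exp_log_div_le : ∃ C : ℝ, 0 ≤ C ∧ ∀ y : ℝ, exp 1 ≤ y → ∀ Q ⊆ primesOneModFour y,
    ∑ p ∈ Q, exp (log p / log y) / (p : ℝ) ≤ ∑ p ∈ Q, 1 / (p : ℝ) + C := by
  obtain ⟨C, hC0, hC⟩ := sum_prime_log_div_le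
  refine ⟨2 * (1 + C), by positivity, fun y hy Q hQ ↦ ?_⟩
  have hy0 : 0 < y := (exp_pos 1).trans_le hy
  have hy1 : 1 ≤ y := (one_le_exp zero_le_one).trans hy
  have h1 : 1 ≤ log y := (le_log_iff_exp_le hy0).2 hy
  have h2 : ∑ p ∈ Q, log p / p ≤ log y + C := by
    refine le_trans (sum_le_sum_of_subset_of_nonneg ?_ fun _ _ _ ↦ ?_) (hC y hy1)
    · intro p hp
      have := hQ hp
      rw [primesOneModFour, mem_filter] at this
      exact mem_filter.2 ⟨this.1, this.2.1⟩
    · positivity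
  have h3 : ∑ p ∈ Q, exp (log p / log y) / (p : ℝ) ≤
      ∑ p ∈ Q, (1 / (p : ℝ) + 2 / log y * (log p / p)) := by
    refine sum_le_sum fun p hp ↦ ?_
    have hp := mem_primesOneModFour.1 (hQ hp)
    have hp1 : (1 : ℝ) ≤ p := by exact_mod_cast hp.1.one_le
    have ht0 : 0 ≤ log p / log y := div_nonneg (log_nonneg hp1) (by linarith)
    have ht1 : log p / log y ≤ 1 :=
      (div_le_one (by linarith)).2 (log_le_log (by linarith) hp.2.2)
    have h4 := abs_le.1 (abs_exp_sub_one_le (x := log p / log y) (by rwa [abs_of_nonneg ht0]))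
    rw [abs_of_nonneg ht0] at h4
    calc _ ≤ (1 + 2 * (log p / log y)) / (p : ℝ) := by gcongr; linarith
      _ = _ := by field_simp
  refine h3.trans ?_
  rw [sum_add_distrib, ← mul_sum]
  refine add_le_add le_rfl ?_
  calc _ ≤ 2 / log y * (log y + C) := by gcongr
    _ = 2 * (1 + C / log y) := by field_simp
    _ ≤ _ := by gcongr; exact div_le_self hC0 h1
lemma sum_powersetCard_insert_prod {ι : Type*} [DecidableEq ι] (w : ι → ℝ) {q : ι} {Q : Finset ι}
    (hq : q ∉ Q) (j : ℕ) :
    ∑ S ∈ powersetCard (j + 1) (insert q Q), ∏ p ∈ S, w p =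
      ∑ S ∈ powersetCard (j + 1) Q, ∏ p ∈ S, w p +
        w q * ∑ S ∈ powersetCard j Q, ∏ p ∈ S, w p := by
  rw [powersetCard_succ_insert hq, sum_union, sum_image, mul_sum]
  · congr 1
    refine sum_congr rfl fun S hS ↦ prod_insert fun h ↦ hq ((mem_powersetCard.1 hS).1 h)
  · intro S hS T hT h
    have h1 : q ∉ S := fun h ↦ hq ((mem_powersetCard.1 hS).1 h)
    have h2 : q ∉ T := fun h ↦ hq ((mem_powersetCard.1 hT).1 h)
    rw [← erase_insert h1, ← erase_insert h2, h]
  · rw [disjoint_left]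
    intro S hS hS'
    obtain ⟨T, -, rfl⟩ := mem_image.1 hS'
    exact hq ((mem_powersetCard.1 hS).1 (mem_insert_self q T))

lemma pow_succ_add_mul_le_add_pow {x w : ℝ} (hx : 0 ≤ x) (hw : 0 ≤ w) (n : ℕ) :
    x ^ (n + 1) + (n + 1) * (w * x ^ n) ≤ (x + w) ^ (n + 1) := by
  induction n with
  | zero => simp
  | succ n ih =>
    have h1 : (x + w) ^ (n + 2) = (x + w) * (x + w) ^ (n + 1) := by ring
    rw [h1]
    have h2 := mul_le_mul_of_nonneg_left ih (show 0 ≤ x + w by positivity)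
    have h3 : 0 ≤ (n + 1) * (w * w * x ^ n) := by positivity
    refine le_trans ?_ h2
    push_cast
    ring_nf at *
    nlinarith

lemma add_pow_le_taylor {x w : ℝ} (hx : 0 ≤ x) (hw : 0 ≤ w) (n : ℕ) :
    (x + w) ^ (n + 2) ≤ x ^ (n + 2) + (n + 2) * (w * x ^ (n + 1)) +
      (n + 2) * (n + 1) / 2 * (w ^ 2 * (x + w) ^ n) := by
  induction n with
  | zero => norm_num; nlinarith
  | succ n ih =>
    have h1 : (x + w) ^ (n + 3) = (x + w) * (x + w) ^ (n + 2) := by ring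
    rw [h1]
    have h2 := mul_le_mul_of_nonneg_left ih (show 0 ≤ x + w by positivity)
    have h3 : (n + 2) * (w ^ 2 * x ^ (n + 1)) ≤ (n + 2) * (w ^ 2 * (x + w) ^ (n + 1)) := by
      gcongr; linarith
    refine h2.trans ?_
    push_cast
    have e : (x + w) * (x ^ (n + 2) + (n + 2) * (w * x ^ (n + 1)) +
      (n + 2) * (n + 1) / 2 * (w ^ 2 * (x + w) ^ n)) = x ^ (n + 3) +
      (n + 3) * (w * x ^ (n + 2)) + (n + 2) * (w ^ 2 * x ^ (n + 1)) +
      (n + 2) * (n + 1) / 2 * (w ^ 2 * (x + w) ^ (n + 1)) := by ring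
    rw [e]
    have e2 : (n + 1 + 2) * (n + 1 + 1) / 2 * (w ^ 2 * (x + w) ^ (n + 1)) =
      (n + 2) * (n + 1) / 2 * (w ^ 2 * (x + w) ^ (n + 1)) +
      (n + 2) * (w ^ 2 * (x + w) ^ (n + 1)) := by ring
    rw [e2]
    have e3 : x ^ (n + 1 + 2) + (n + 1 + 2) * (w * x ^ (n + 1 + 1)) =
      x ^ (n + 3) + (n + 3) * (w * x ^ (n + 2)) := by ring
    linarith

lemma factorial_mul_sum_powersetCard_prod_le {ι : Type*} (w : ι → ℝ) (Q : Finset ι)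
    (hw : ∀ i, 0 ≤ w i) (j : ℕ) :
    j.factorial * ∑ S ∈ powersetCard j Q, ∏ p ∈ S, w p ≤ (∑ p ∈ Q, w p) ^ j := by
  classical
  induction Q using Finset.induction_on generalizing j with
  | empty =>
    cases j with
    | zero => simp
    | succ j => simp [powersetCard_eq_empty.2 (show #(∅ : Finset ι) < j + 1 by simp)]
  | insert q Q hq ih =>
    cases j with
    | zero => simp
    | succ j =>
      rw [sum_powersetCard_insert_prod w hq, sum_insert hq, add_comm (w q)]
      refine le_trans ?_ (pow_succ_add_mul_le_add_pow (sum_nonneg fun i _ ↦ hw i) (hw q) j)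
      have h1 := ih (j + 1)
      have h2 := mul_le_mul_of_nonneg_left (ih j) (hw q)
      rw [Nat.factorial_succ, Nat.cast_mul] at *
      push_cast at *
      nlinarith [mul_le_mul_of_nonneg_left h2 (show (0 : ℝ) ≤ j + 1 by positivity)]

lemma le_factorial_mul_sum_powersetCard_prod {ι : Type*} (w : ι → ℝ) (Q : Finset ι)
    (hw : ∀ i, 0 ≤ w i) (j : ℕ) :
    (∑ p ∈ Q, w p) ^ j - j * (j - 1) / 2 * ((∑ p ∈ Q, w p ^ 2) * (∑ p ∈ Q, w p) ^ (j - 2)) ≤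
      j.factorial * ∑ S ∈ powersetCard j Q, ∏ p ∈ S, w p := by
  classical
  induction Q using Finset.induction_on generalizing j with
  | empty =>
    cases j with
    | zero => simp
    | succ j => simp [powersetCard_eq_empty.2 (show #(∅ : Finset ι) < j + 1 by simp)]
  | insert q Q hq ih =>
    match j with
    | 0 => simp
    | 1 => rw [powersetCard_one, sum_map]; simp
    | j + 2 =>
      rw [sum_powersetCard_insert_prod w hq, sum_insert hq, sum_insert hq, add_comm (w q)]
      have hP : 0 ≤ ∑ p ∈ Q, w p := sum_nonneg fun i _ ↦ hw i
      have hP2 : 0 ≤ ∑ p ∈ Q, w p ^ 2 := sum_nonneg fun i _ ↦ by positivity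
      have h1 := ih (j + 2)
      have h2 := mul_le_mul_of_nonneg_left (ih (j + 1))
        (show 0 ≤ (j + 2) * w q from mul_nonneg (by positivity) (hw q))
      have h3 := add_pow_le_taylor hP (hw q) j
      have h4 : (∑ p ∈ Q, w p) ^ j + j * (w q * (∑ p ∈ Q, w p) ^ (j - 1)) ≤
          ((∑ p ∈ Q, w p) + w q) ^ j := by
        cases j with
        | zero => simp
        | succ j => simpa using pow_succ_add_mul_le_add_pow hP (hw q) j
      have h5 := mul_le_mul_of_nonneg_left h4
        (show 0 ≤ (j + 2) * (j + 1) / 2 * ∑ p ∈ Q, w p ^ 2 by positivity)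
      set P := ∑ p ∈ Q, w p
      set P₂ := ∑ p ∈ Q, w p ^ 2
      set E := ∑ S ∈ powersetCard (j + 2) Q, ∏ p ∈ S, w p
      set F := ∑ S ∈ powersetCard (j + 1) Q, ∏ p ∈ S, w p
      have e2 : (((j + 2).factorial : ℕ) : ℝ) = (j + 2) * (j + 1).factorial := by
        rw [Nat.factorial_succ]; push_cast; ring
      have e3 : ((j + 2 : ℕ) : ℝ) - 1 = j + 1 := by push_cast; ring
      have e4 : ((j + 1 : ℕ) : ℝ) - 1 = j := by push_cast; ring
      rw [e3] at h1 ⊢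
      rw [e4] at h2
      simp only [Nat.add_sub_cancel, show j + 1 - 2 = j - 1 by omega] at *
      rw [mul_add _ E, show ((j + 2).factorial : ℝ) * (w q * F) =
        (j + 2) * w q * ((j + 1).factorial * F) by rw [e2]; ring]
      push_cast at *
      generalize ((j + 2).factorial : ℝ) * E = E' at *
      generalize ((j + 1).factorial : ℝ) * F = F' at *
      generalize P ^ (j - 1) = u at *
      generalize (P + w q) ^ j = v at *
      linarith
lemma sum_one_div_sq_le {Q : Finset ℕ} {k : ℕ} (hQ : ∀ p ∈ Q, k < p) :
    ∑ p ∈ Q, (1 / (p : ℝ)) ^ 2 ≤ 2 / ((k : ℝ) + 1) := by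
  refine le_trans (sum_le_sum_of_subset_of_nonneg (t := Ioo k (Q.sup id + 1)) ?_
    fun _ _ _ ↦ by positivity) ?_
  · intro p hp
    exact mem_Ioo.2 ⟨hQ p hp, Nat.lt_succ_of_le (le_sup (f := id) hp)⟩
  · simpa using sum_Ioo_inv_sq_le (α := ℝ) k (Q.sup id + 1)

lemma half_pow_le_factorial_mul_sum_powersetCard {ι : Type*} (w : ι → ℝ) (Q : Finset ι)
    (hw : ∀ i, 0 ≤ w i) {A : ℝ} {j : ℕ} (hj : j ≤ A * ∑ p ∈ Q, w p)
    (hA : A ^ 2 * ∑ p ∈ Q, w p ^ 2 ≤ 1) :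
    (∑ p ∈ Q, w p) ^ j / 2 ≤ j.factorial * ∑ S ∈ powersetCard j Q, ∏ p ∈ S, w p := by
  refine le_trans ?_ (le_factorial_mul_sum_powersetCard_prod w Q hw j)
  have hP : 0 ≤ ∑ p ∈ Q, w p := sum_nonneg fun i _ ↦ hw i
  have hP2 : 0 ≤ ∑ p ∈ Q, w p ^ 2 := sum_nonneg fun i _ ↦ by positivity
  set P := ∑ p ∈ Q, w p
  set P₂ := ∑ p ∈ Q, w p ^ 2
  match j with
  | 0 => norm_num
  | 1 => norm_num; linarith
  | j + 2 =>
    have h1 : ((j + 2 : ℕ) : ℝ) * ((j + 2 : ℕ) - 1) ≤ A ^ 2 * P ^ 2 := by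
      push_cast at hj ⊢
      have h0 : (0 : ℝ) ≤ j := by positivity
      nlinarith
    have h2 : ((j + 2 : ℕ) : ℝ) * ((j + 2 : ℕ) - 1) / 2 * (P₂ * P ^ j) ≤
        A ^ 2 * P ^ 2 / 2 * (P₂ * P ^ j) := by gcongr
    have h3 : A ^ 2 * P₂ * (P ^ (j + 2) / 2) ≤ 1 * (P ^ (j + 2) / 2) := by gcongr
    have h4 : A ^ 2 * P ^ 2 / 2 * (P₂ * P ^ j) = A ^ 2 * P₂ * (P ^ (j + 2) / 2) := by ring
    rw [Nat.add_sub_cancel]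
    linarith

lemma quarter_pow_le_sum_powersetCard_prod_le : ∃ C : ℝ, 0 ≤ C ∧
    ∀ (A R y Z : ℝ) (Q : Finset ℕ) (j : ℕ), exp 1 ≤ y → Q ⊆ primesOneModFour y →
      j ≤ A * ∑ p ∈ Q, 1 / (p : ℝ) → A ^ 2 * ∑ p ∈ Q, (1 / (p : ℝ)) ^ 2 ≤ 1 →
      0 < Z → R * log y ≤ log Z → exp (C * A - R) ≤ 1 / 4 → 0 < ∑ p ∈ Q, 1 / (p : ℝ) →
      (∑ p ∈ Q, 1 / (p : ℝ)) ^ j / 4 ≤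
        j.factorial * ∑ S ∈ powersetCard j Q with (((∏ p ∈ S, p : ℕ) : ℝ) ≤ Z),
          1 / ((∏ p ∈ S, p : ℕ) : ℝ) := by
  obtain ⟨C, hC0, hC⟩ := sum_exp_log_div_le
  refine ⟨C, hC0, fun A R y Z Q j hy hQ hj hA hZ hR hCA hP ↦ ?_⟩
  have h1 := half_pow_le_factorial_mul_sum_powersetCard (fun p : ℕ ↦ 1 / (p : ℝ)) Q
    (fun _ ↦ by positivity) hj hA
  have h2 := factorial_mul_sum_powersetCard_prod_le
    (fun p : ℕ ↦ exp (log p / log y) / (p : ℝ)) Q (fun _ ↦ by positivity) j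
  have h3 := hC y hy Q hQ
  have hy0 : 0 < y := (exp_pos 1).trans_le hy
  have hlog : 1 ≤ log y := (le_log_iff_exp_le hy0).2 hy
  set P := ∑ p ∈ Q, 1 / (p : ℝ) with hPdef
  have h4 : (∑ p ∈ Q, exp (log p / log y) / (p : ℝ)) ^ j ≤ P ^ j * exp (C * A) := by
    calc _ ≤ (P + C) ^ j := by gcongr
      _ = P ^ j * (C / P + 1) ^ j := by rw [← mul_pow]; congr 1; field_simp; ring
      _ ≤ P ^ j * exp (C / P) ^ j := by gcongr; exact add_one_le_exp _
      _ ≤ _ := by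
        rw [← exp_nat_mul]
        refine mul_le_mul_of_nonneg_left (exp_le_exp.2 ?_) (by positivity)
        rw [mul_div_assoc', div_le_iff₀ hP]
        nlinarith
  have h5 : ∑ S ∈ powersetCard j Q with ¬ (((∏ p ∈ S, p : ℕ) : ℝ) ≤ Z),
      1 / ((∏ p ∈ S, p : ℕ) : ℝ) ≤ exp (-R) *
        ∑ S ∈ powersetCard j Q, ∏ p ∈ S, exp (log p / log y) / (p : ℝ) := by
    rw [mul_sum, sum_filter]
    refine sum_le_sum fun S hS ↦ ?_
    split_ifs with hSZ
    · positivity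
    · have hpos : ∀ p ∈ S, (0 : ℝ) < p := fun p hp ↦ by
        exact_mod_cast (mem_primesOneModFour.1 (hQ ((mem_powersetCard.1 hS).1 hp))).1.pos
      rw [prod_div_distrib, ← exp_sum, ← sum_div, ← Real.log_prod fun p hp ↦ (hpos p hp).ne',
        ← Nat.cast_prod, mul_div_assoc', ← exp_add]
      have hp0 : 0 < ((∏ p ∈ S, p : ℕ) : ℝ) := by rw [Nat.cast_prod]; exact prod_pos hpos
      gcongr
      rw [one_le_exp_iff]
      have : R ≤ log ((∏ p ∈ S, p : ℕ) : ℝ) / log y := by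
        rw [le_div_iff₀ (by linarith)]
        exact hR.trans (log_le_log hZ (not_le.1 hSZ).le)
      linarith
  have h6 := sum_filter_add_sum_filter_not (powersetCard j Q)
    (fun S ↦ ((∏ p ∈ S, p : ℕ) : ℝ) ≤ Z) (fun S ↦ 1 / ((∏ p ∈ S, p : ℕ) : ℝ))
  have h7 : ∑ S ∈ powersetCard j Q, ∏ p ∈ S, 1 / (p : ℝ) =
      ∑ S ∈ powersetCard j Q, 1 / ((∏ p ∈ S, p : ℕ) : ℝ) := by
    refine sum_congr rfl fun S _ ↦ ?_
    rw [prod_div_distrib, prod_const_one, Nat.cast_prod]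
  rw [h7, ← h6, mul_add] at h1
  have h8 := mul_le_mul_of_nonneg_left h5 (Nat.cast_nonneg (α := ℝ) j.factorial)
  have h9 : exp (-R) * (j.factorial *
      ∑ S ∈ powersetCard j Q, ∏ p ∈ S, exp (log p / log y) / (p : ℝ)) ≤ P ^ j / 4 := by
    calc _ ≤ exp (-R) * (P ^ j * exp (C * A)) := 
        mul_le_mul_of_nonneg_left (h2.trans h4) (by positivity)
      _ = P ^ j * exp (C * A - R) := by rw [sub_eq_add_neg, exp_add]; ring
      _ ≤ P ^ j * (1 / 4) := by gcongr
      _ = _ := by ring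
  linarith

end

lemma irrational_log_five_div_log_thirteen : Irrational (log 5 / log 13) := by
  rintro ⟨q, hq⟩
  have h5 : 0 < log 5 := log_pos (by norm_num)
  have h13 : 0 < log 13 := log_pos (by norm_num)
  have hq0 : 0 < q := by
    have : (0 : ℝ) < q := by rw [hq]; positivity
    exact_mod_cast this
  have hnum : 0 < q.num := Rat.num_pos.2 hq0
  obtain ⟨n, hn⟩ := Int.eq_ofNat_of_zero_le hnum.le
  have hden := q.den_pos
  have e : (q : ℝ) = n / q.den := by
    rw [Rat.cast_def, hn]; simp
  rw [e, div_eq_div_iff (by positivity) (by positivity), mul_comm (log 5), ← log_pow,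
    ← log_pow] at hq
  have h := log_injOn_pos (Set.mem_Ioi.2 (by positivity)) (Set.mem_Ioi.2 (by positivity)) hq
  have h' : 13 ^ n = 5 ^ q.den := by exact_mod_cast h
  have h1 : 13 ∣ 5 ^ q.den := h' ▸ dvd_pow_self 13 (by omega)
  have := (by norm_num : Nat.Prime 13).dvd_of_dvd_pow h1
  omega

lemma exists_nat_mul_add_nat_mul_mem_Icc {u v ε : ℝ} (hu : 0 < u)
    (huv : Irrational (u / v)) (hε : 0 < ε) :
    ∃ T₀ : ℝ, ∀ T, T₀ ≤ T → ∃ i j : ℕ, 1 ≤ i ∧ 1 ≤ j ∧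
      T ≤ i * u + j * v ∧ i * u + j * v ≤ T + ε := by
  obtain ⟨δ, hmem, hδ0, hδ⟩ := (dense_addSubgroupClosure_pair_iff.2 huv).exists_mem_open
    isOpen_Ioo (⟨ε / 2, by constructor <;> linarith⟩ : (Set.Ioo 0 ε).Nonempty)
  obtain ⟨m, n, hmn⟩ := AddSubgroup.mem_closure_pair.1 hmem
  simp only [zsmul_eq_mul] at hmn
  set k₀ := ⌈u / δ⌉₊
  set W := k₀ * (m.natAbs + n.natAbs) + 1 with hW
  refine ⟨W * (u + v), fun T hT ↦ ?_⟩
  set a := ⌊(T - W * (u + v)) / u⌋₊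
  have ha1 : a * u ≤ T - W * (u + v) :=
    (le_div_iff₀ hu).1 (Nat.floor_le (div_nonneg (by linarith) hu.le))
  have ha2 : T - W * (u + v) < (a + 1) * u := (div_lt_iff₀ hu).1 (Nat.lt_floor_add_one _)
  set r := T - W * (u + v) - a * u with hr
  set k := ⌈r / δ⌉₊
  have hk : k ≤ k₀ := Nat.ceil_mono (div_le_div_of_nonneg_right (by linarith) hδ0.le)
  have hk1 : r ≤ k * δ := (div_le_iff₀ hδ0).1 (Nat.le_ceil _)
  have hk2 : k * δ < r + δ := by
    have := Nat.ceil_lt_add_one (show 0 ≤ r / δ from div_nonneg (by linarith) hδ0.le)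
    rw [div_add_one hδ0.ne', lt_div_iff₀ hδ0] at this
    exact this
  have hkm : k * m.natAbs ≤ k₀ * m.natAbs := Nat.mul_le_mul_right _ hk
  have hkn : k * n.natAbs ≤ k₀ * n.natAbs := Nat.mul_le_mul_right _ hk
  have hm : |(k : ℤ) * m| ≤ k₀ * m.natAbs := by
    rw [abs_mul, Nat.abs_cast, Int.abs_eq_natAbs]; exact_mod_cast hkm
  have hn : |(k : ℤ) * n| ≤ k₀ * n.natAbs := by
    rw [abs_mul, Nat.abs_cast, Int.abs_eq_natAbs]; exact_mod_cast hkn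
  have hm0 : (0 : ℤ) ≤ k₀ * m.natAbs := by positivity
  have hn0 : (0 : ℤ) ≤ k₀ * n.natAbs := by positivity
  have hWz : (W : ℤ) = k₀ * m.natAbs + k₀ * n.natAbs + 1 := by rw [hW]; push_cast; ring
  have hi : 1 ≤ (W : ℤ) + k * m + a := by
    have := (abs_le.1 hm).1
    linarith [Int.natCast_nonneg a]
  have hj : 1 ≤ (W : ℤ) + k * n := by
    have := (abs_le.1 hn).1
    linarith
  obtain ⟨i, hi'⟩ := Int.eq_ofNat_of_zero_le (zero_le_one.trans hi)
  obtain ⟨j, hj'⟩ := Int.eq_ofNat_of_zero_le (zero_le_one.trans hj)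
  have hiR : (i : ℝ) = W + k * m + a := by exact_mod_cast hi'.symm
  have hjR : (j : ℝ) = W + k * n := by exact_mod_cast hj'.symm
  have e : i * u + j * v = T - r + k * δ := by rw [hiR, hjR, ← hmn, hr]; ring
  exact ⟨i, j, by omega, by omega, by linarith, by linarith⟩

lemma exists_five_pow_mul_thirteen_pow_mem_Icc {ρ : ℝ} (hρ : 1 < ρ) :
    ∃ x₀ : ℝ, 0 < x₀ ∧ ∀ x, x₀ ≤ x → ∃ i j : ℕ, 1 ≤ i ∧ 1 ≤ j ∧
      x ≤ ((5 ^ i * 13 ^ j : ℕ) : ℝ) ∧ ((5 ^ i * 13 ^ j : ℕ) : ℝ) ≤ x * ρ := by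
  obtain ⟨T₀, hT₀⟩ := exists_nat_mul_add_nat_mul_mem_Icc (log_pos (by norm_num))
    irrational_log_five_div_log_thirteen (log_pos hρ)
  refine ⟨exp T₀, exp_pos _, fun x hx ↦ ?_⟩
  have hx0 : 0 < x := (exp_pos _).trans_le hx
  obtain ⟨i, j, hi, hj, h1, h2⟩ := hT₀ (log x) ((le_log_iff_exp_le hx0).2 hx)
  have e : (i * log 5 + j * log 13 : ℝ) = log ((5 ^ i * 13 ^ j : ℕ) : ℝ) := by
    push_cast
    rw [log_mul (by positivity) (by positivity), log_pow, log_pow]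
  rw [e] at h1 h2
  rw [← log_mul hx0.ne' (by linarith)] at h2
  exact ⟨i, j, hi, hj, (log_le_log_iff hx0 (by positivity)).1 h1,
    (log_le_log_iff (by positivity) (by positivity)).1 h2⟩

lemma rTwoSquares_eq_ncard_norm (n : ℕ) :
    rTwoSquares n = {z : GaussianInt | z.norm = n}.ncard := by
  refine Set.ncard_congr (fun p _ ↦ (⟨p.1, p.2⟩ : GaussianInt)) ?_ ?_ ?_
  · intro p hp
    simp only [Set.mem_ofPred_eq, Zsqrtd.norm_def] at hp ⊢
    linarith
  · rintro ⟨a, b⟩ ⟨c, d⟩ - - h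
    simpa [Zsqrtd.ext_iff] using h
  · rintro ⟨a, b⟩ hz
    refine ⟨(a, b), ?_, rfl⟩
    simp only [Set.mem_ofPred_eq, Zsqrtd.norm_def] at hz ⊢
    linarith

lemma finite_setOf_gaussianInt_norm_eq (n : ℕ) : {z : GaussianInt | z.norm = n}.Finite := by
  refine Set.Finite.of_finite_image (f := fun z : GaussianInt ↦ (z.re, z.im)) ?_ ?_
  · refine ((Set.finite_Icc (-(n : ℤ)) n).prod (Set.finite_Icc (-(n : ℤ)) n)).subset ?_
    rintro _ ⟨z, hz, rfl⟩
    simp only [Set.mem_ofPred_eq, Zsqrtd.norm_def] at hz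
    simp only [Set.mem_prod, Set.mem_Icc]
    refine ⟨⟨?_, ?_⟩, ?_, ?_⟩ <;> nlinarith [Int.le_self_sq z.re, Int.le_self_sq z.im,
      Int.le_self_sq (-z.re), Int.le_self_sq (-z.im)]
  · rintro ⟨a, b⟩ - ⟨c, d⟩ - h
    simpa [Zsqrtd.ext_iff] using h

lemma two_mul_rTwoSquares_le {p : ℕ} (hp : p.Prime) (hp4 : p % 4 = 1) {n : ℕ} (hn : ¬ p ∣ n)
    {e : ℕ} (he : 0 < e) : 2 * rTwoSquares n ≤ rTwoSquares (p ^ e * n) := by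
  have := Fact.mk hp
  obtain ⟨s, t, hst⟩ := Nat.Prime.sq_add_sq (p := p) (by omega)
  have hstz : (s : ℤ) ^ 2 + (t : ℤ) ^ 2 = p := by exact_mod_cast hst
  set π₁ : GaussianInt := ⟨s, t⟩ with hπ₁
  set π₂ : GaussianInt := ⟨s, -t⟩ with hπ₂
  have hn1 : π₁.norm = p := by rw [Zsqrtd.norm_def, ← hstz]; ring
  have hn2 : π₂.norm = p := by rw [Zsqrtd.norm_def, ← hstz]; ring
  have hmul : π₁ * π₂ = ((p : ℤ) : GaussianInt) := by
    ext
    · simp [hπ₁, hπ₂]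
      linarith
    · simp [hπ₁, hπ₂]
      ring
  have hadd : π₁ + π₂ = ((2 * s : ℤ) : GaussianInt) := by
    ext <;> simp [hπ₁, hπ₂]; ring
  have hp0 : (p : ℤ) ≠ 0 := by exact_mod_cast hp.ne_zero
  have hπ₁0 : π₁ ≠ 0 := by rintro h; rw [h] at hn1; simp at hn1; exact hp0 hn1.symm
  have hπ₂0 : π₂ ≠ 0 := by rintro h; rw [h] at hn2; simp at hn2; exact hp0 hn2.symm
  have hcop : IsCoprime (2 * s : ℤ) (p : ℤ) := by
    have h2 : Nat.Coprime p (2 * s) := by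
      rw [hp.coprime_iff_not_dvd]
      intro h
      rcases hp.dvd_mul.1 h with h | h
      · have := Nat.le_of_dvd two_pos h
        have := hp.two_le
        have : p = 2 := by omega
        omega
      · have h3 : p ∣ t ^ 2 := by
          rw [← Nat.dvd_add_right (dvd_pow h two_ne_zero), hst]
        have h4 := hp.dvd_of_dvd_pow h3
        have h5 : p * p ∣ s ^ 2 + t ^ 2 := by
          rw [← sq]; exact dvd_add (pow_dvd_pow_of_dvd h 2) (pow_dvd_pow_of_dvd h4 2)
        rw [hst] at h5
        have := Nat.le_of_dvd hp.pos h5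
        nlinarith [hp.two_le]
    have := (Nat.isCoprime_iff_coprime.2 h2).symm
    exact_mod_cast this
  have hcop' : IsCoprime (π₁ ^ e) (π₂ ^ e) := by
    refine IsCoprime.pow ?_
    obtain ⟨a, b, hab⟩ := hcop
    refine ⟨a + b * π₂, a, ?_⟩
    have h1 :
        (a : GaussianInt) * ((2 * s : ℤ) : GaussianInt) + b * ((p : ℤ) : GaussianInt) = 1 := by
      rw [← Int.cast_mul, ← Int.cast_mul, ← Int.cast_add, hab, Int.cast_one]
    rw [← hadd, ← hmul] at h1
    linear_combination h1
  have hnorm (w : GaussianInt) (h : w.norm = p) (z : GaussianInt) (hz : z.norm = n) :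
      (z * w ^ e).norm = (p ^ e * n : ℕ) := by
    have : (w ^ e).norm = (p : ℤ) ^ e := by
      rw [← h]; exact map_pow Zsqrtd.normMonoidHom w e
    rw [Zsqrtd.norm_mul, this, hz]; push_cast; ring
  rw [rTwoSquares_eq_ncard_norm, rTwoSquares_eq_ncard_norm]
  set N := {z : GaussianInt | z.norm = n}
  have hfin : N.Finite := finite_setOf_gaussianInt_norm_eq n
  have hsub : (fun z ↦ z * π₁ ^ e) '' N ∪ (fun z ↦ z * π₂ ^ e) '' N ⊆
      {z : GaussianInt | z.norm = (p ^ e * n : ℕ)} := by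
    rintro _ (⟨z, hz, rfl⟩ | ⟨z, hz, rfl⟩)
    · exact hnorm _ hn1 z hz
    · exact hnorm _ hn2 z hz
  have hdisj : Disjoint ((fun z ↦ z * π₁ ^ e) '' N) ((fun z ↦ z * π₂ ^ e) '' N) := by
    rw [Set.disjoint_left]
    rintro _ ⟨z, hz, rfl⟩ ⟨w, hw, h⟩
    have hd : π₁ ^ e ∣ w := hcop'.dvd_of_dvd_mul_right (Dvd.intro_left z h.symm)
    obtain ⟨v, rfl⟩ := hd
    have h1 : ((π₁ ^ e * v).norm : ℤ) = n := hw
    rw [Zsqrtd.norm_mul] at h1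
    have h2 : (π₁ ^ e).norm = (p : ℤ) ^ e := by
      rw [← hn1]; exact map_pow Zsqrtd.normMonoidHom π₁ e
    rw [h2] at h1
    have h3 : (p : ℤ) ∣ n := by
      rw [← h1]; exact (dvd_pow_self _ he.ne').mul_right _
    exact hn (by exact_mod_cast h3)
  calc 2 * N.ncard = ((fun z ↦ z * π₁ ^ e) '' N).ncard + ((fun z ↦ z * π₂ ^ e) '' N).ncard := by
        rw [Set.ncard_image_of_injective _ (mul_left_injective₀ (pow_ne_zero e hπ₁0)),
          Set.ncard_image_of_injective _ (mul_left_injective₀ (pow_ne_zero e hπ₂0)), two_mul]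
    _ = _ := (Set.ncard_union_eq hdisj (hfin.image _) (hfin.image _)).symm
    _ ≤ _ := Set.ncard_le_ncard hsub (finite_setOf_gaussianInt_norm_eq _)

lemma two_pow_card_primeFactors_le_rTwoSquares {n : ℕ} (hn : n ∈ A1) :
    2 ^ n.primeFactors.card ≤ rTwoSquares n := by
  induction n using Nat.recOnPrimePow with
  | zero => exact absurd hn.1 (lt_irrefl 0)
  | one =>
    rw [rTwoSquares_eq_ncard_norm, Nat.primeFactors_one, Finset.card_empty, pow_zero]
    exact (Set.ncard_pos (finite_setOf_gaussianInt_norm_eq 1)).2 ⟨1, by simp⟩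
  | prime_pow_mul a p e hp hpa he ih =>
    have ha : 0 < a := Nat.pos_of_mul_pos_left hn.1
    have hp4 : p % 4 = 1 := hn.2 p hp ((dvd_pow_self p he.ne').mul_right a)
    have h1 := ih ⟨ha, fun q hq hqa ↦ hn.2 q hq (hqa.mul_left _)⟩
    have h2 := two_mul_rTwoSquares_le hp hp4 hpa he
    have hcop : Nat.Coprime (p ^ e) a := Nat.Coprime.pow_left e ((hp.coprime_iff_not_dvd).2 hpa)
    rw [hcop.primeFactors_mul, Finset.card_union_of_disjoint hcop.disjoint_primeFactors,
      Nat.primeFactors_prime_pow he.ne' hp, Finset.card_singleton, pow_add, pow_one]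
    omega

section
open Finset

lemma primeFactors_prod_mul_five_pow_mul_thirteen_pow_mul {S : Finset ℕ} {p i j : ℕ}
    (hS : ∀ q ∈ S, q.Prime) (hp : p.Prime) (hi : 1 ≤ i) (hj : 1 ≤ j) :
    ((∏ q ∈ S, q) * (5 ^ i * 13 ^ j) * p).primeFactors = S ∪ {5, 13, p} := by
  have h5 : Nat.Prime 5 := by norm_num
  have h13 : Nat.Prime 13 := by norm_num
  have h0 : ∏ q ∈ S, q ≠ 0 := prod_ne_zero_iff.2 fun q hq ↦ (hS q hq).ne_zero
  rw [Nat.primeFactors_mul (by positivity) hp.ne_zero, Nat.primeFactors_mul h0 (by positivity),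
    Nat.primeFactors_mul (by positivity) (by positivity), Nat.primeFactors_prod hS,
    Nat.primeFactors_prime_pow (by omega) h5, Nat.primeFactors_prime_pow (by omega) h13,
    hp.primeFactors]
  ext q
  simp

lemma card_union_five_thirteen {S : Finset ℕ} {p : ℕ} (hS : ∀ q ∈ S, 13 < q ∧ q < p)
    (hp : 13 < p) : #(S ∪ {5, 13, p}) = #S + 3 := by
  have hd : Disjoint S {5, 13, p} := by
    rw [disjoint_left]
    intro q hq h
    have := hS q hq
    simp only [mem_insert, mem_singleton] at h
    omega
  rw [card_union_of_disjoint hd, card_eq_three.2 ⟨5, 13, p, by omega, by omega, by omega, rfl⟩]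

lemma eq_and_eq_of_union_five_thirteen_eq {S T : Finset ℕ} {p q : ℕ}
    (hS : ∀ r ∈ S, 13 < r ∧ r < p) (hT : ∀ r ∈ T, 13 < r ∧ r < q)
    (hp : 13 < p) (hq : 13 < q) (h : S ∪ {5, 13, p} = T ∪ {5, 13, q}) : S = T ∧ p = q := by
  have hmem (r : ℕ) : r ∈ S ∨ r = 5 ∨ r = 13 ∨ r = p ↔ r ∈ T ∨ r = 5 ∨ r = 13 ∨ r = q := by
    simpa only [mem_union, mem_insert, mem_singleton] using Finset.ext_iff.1 h r
  have hpq : p = q := by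
    have h1 := (hmem p).1 (by simp)
    have h2 := (hmem q).2 (by simp)
    rcases h1 with h1 | h1 | h1 | h1
    · have := (hT p h1).2
      rcases h2 with h2 | h2 | h2 | h2
      · have := (hS q h2).2
        omega
      all_goals omega
    all_goals omega
  subst hpq
  refine ⟨Finset.ext fun r ↦ ⟨fun hr ↦ ?_, fun hr ↦ ?_⟩, rfl⟩
  · have := hS r hr
    have := (hmem r).1 (Or.inl hr)
    grind
  · have := hT r hr
    have := (hmem r).2 (Or.inl hr)
    grind

set_option maxHeartbeats 1000000 in
lemma sum_two_pow_mul_div_log_le_finsum {a b B D x₀ y Λ : ℝ} {j : ℕ} {Q : Finset ℕ}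
    (ha : 0 < a) (hD : 0 < D) (hx₀ : 0 ≤ x₀)
    (hB : ∀ Y, 1 ≤ Y → Y / log (B * Y) ≤ #(primesOneModFour (B * Y) \ primesOneModFour Y))
    (hx : ∀ x, x₀ ≤ x → ∃ i j : ℕ, 1 ≤ i ∧ 1 ≤ j ∧
      x ≤ ((5 ^ i * 13 ^ j : ℕ) : ℝ) ∧ ((5 ^ i * 13 ^ j : ℕ) : ℝ) ≤ x * (b / a))
    (haD : x₀ * B ≤ a * D) (hy : D * y ≤ Λ) (hΛ : D * 13 ≤ Λ)
    (hQ : ∀ q ∈ Q, q.Prime ∧ q % 4 = 1 ∧ 13 < q ∧ (q : ℝ) ≤ y) :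
    ∑ S ∈ powersetCard j Q with (((∏ p ∈ S, p : ℕ) : ℝ) ≤ Λ),
        2 ^ (j + 3) * (Λ ^ 2 / ((∏ p ∈ S, p : ℕ) * D) /
          log (B * (Λ ^ 2 / ((∏ p ∈ S, p : ℕ) * D)))) ≤
      ∑ᶠ ℓ ∈ {ℓ : ℕ | a * Λ ^ 2 ≤ (ℓ : ℝ) ∧ (ℓ : ℝ) ≤ b * Λ ^ 2 ∧ ℓ ∈ A1 ∧
        ℓ.primeFactors.card = j + 3}, (rTwoSquares ℓ : ℝ) := by
  choose! e₅ e₁₃ he₅ he₁₃ hlo hhi using hx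
  have hΛ0 : 0 < Λ := lt_of_lt_of_le (by positivity) hΛ
  set U := {ℓ : ℕ | a * Λ ^ 2 ≤ (ℓ : ℝ) ∧ (ℓ : ℝ) ≤ b * Λ ^ 2 ∧ ℓ ∈ A1 ∧
        ℓ.primeFactors.card = j + 3} with hU
  have hfin : U.Finite := (Set.finite_Iic ⌊b * Λ ^ 2⌋₊).subset fun ℓ hℓ ↦ Nat.le_floor hℓ.2.1
  set T := {S ∈ powersetCard j Q | (((∏ p ∈ S, p : ℕ) : ℝ) ≤ Λ)} with hT
  set Y : Finset ℕ → ℝ := fun S ↦ Λ ^ 2 / ((∏ p ∈ S, p : ℕ) * D) with hY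
  set I := T.sigma fun S ↦ primesOneModFour (B * Y S) \ primesOneModFour (Y S) with hI
  set t : (Σ _ : Finset ℕ, ℕ) → ℝ := fun w ↦ a * Λ ^ 2 / ((∏ p ∈ w.1, p : ℕ) * w.2) with ht
  set f : (Σ _ : Finset ℕ, ℕ) → ℕ :=
    fun w ↦ (∏ p ∈ w.1, p) * (5 ^ e₅ (t w) * 13 ^ e₁₃ (t w)) * w.2 with hf
  have hm (S : Finset ℕ) (hS : S ∈ T) : 0 < ∏ p ∈ S, p :=
    prod_pos fun q hq ↦ (hQ q ((mem_powersetCard.1 (mem_filter.1 hS).1).1 hq)).1.pos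
  have hYle (S : Finset ℕ) (hS : S ∈ T) : Λ / D ≤ Y S := by
    have h0 : (0 : ℝ) < (∏ p ∈ S, p : ℕ) := by exact_mod_cast hm S hS
    rw [hY, div_le_div_iff₀ hD (by positivity)]
    have := (mem_filter.1 hS).2
    nlinarith [mul_le_mul_of_nonneg_left this (mul_pos hΛ0 hD).le]
  have hbig (w) (hw : w ∈ I) : w.2.Prime ∧ w.2 % 4 = 1 ∧ 13 < w.2 ∧ (∀ q ∈ w.1, 13 < q ∧ q < w.2) ∧
      Y w.1 < w.2 ∧ w.2 ≤ B * Y w.1 := by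
    obtain ⟨hS, hp⟩ := mem_sigma.1 hw
    obtain ⟨hp1, hp2⟩ := mem_sdiff.1 hp
    rw [mem_primesOneModFour] at hp1 hp2
    have hlt : Y w.1 < w.2 := by
      by_contra! h
      exact hp2 ⟨hp1.1, hp1.2.1, h⟩
    have h13 : 13 < w.2 := by
      have : (13 : ℝ) ≤ Λ / D := (le_div_iff₀ hD).2 (by linarith)
      have : (13 : ℝ) < w.2 := by linarith [hYle _ hS]
      exact_mod_cast this
    refine ⟨hp1.1, hp1.2.1, h13, fun q hq ↦ ?_, hlt, hp1.2.2⟩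
    have hq' := hQ q ((mem_powersetCard.1 (mem_filter.1 hS).1).1 hq)
    refine ⟨hq'.2.2.1, ?_⟩
    have : y ≤ Λ / D := (le_div_iff₀ hD).2 (by linarith)
    have : (q : ℝ) < w.2 := by linarith [hYle _ hS, hq'.2.2.2]
    exact_mod_cast this
  have hSprime (w) (hw : w ∈ I) (q) (hq : q ∈ w.1) : q.Prime ∧ q % 4 = 1 := by
    have := hQ q ((mem_powersetCard.1 (mem_filter.1 (mem_sigma.1 hw).1).1).1 hq)
    exact ⟨this.1, this.2.1⟩
  have htx (w) (hw : w ∈ I) : x₀ ≤ t w := by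
    have h0 : (0 : ℝ) < (∏ p ∈ w.1, p : ℕ) := by exact_mod_cast hm w.1 (mem_sigma.1 hw).1
    have h1 : (0 : ℝ) < w.2 := by exact_mod_cast (hbig w hw).1.pos
    have h2 := (hbig w hw).2.2.2.2.2
    rw [hY, ← mul_div_assoc, le_div_iff₀ (by positivity)] at h2
    rw [ht, le_div_iff₀ (by positivity)]
    have h3 : x₀ * ((∏ p ∈ w.1, p : ℕ) * w.2) * D ≤ a * Λ ^ 2 * D := by
      calc x₀ * ((∏ p ∈ w.1, p : ℕ) * w.2) * D = x₀ * (w.2 * ((∏ p ∈ w.1, p : ℕ) * D)) := by ring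
        _ ≤ x₀ * (B * Λ ^ 2) := by gcongr
        _ = x₀ * B * Λ ^ 2 := by ring
        _ ≤ a * D * Λ ^ 2 := by gcongr
        _ = _ := by ring
    exact le_of_mul_le_mul_right h3 hD
  have hpf (w) (hw : w ∈ I) : (f w).primeFactors = w.1 ∪ {5, 13, w.2} :=
    primeFactors_prod_mul_five_pow_mul_thirteen_pow_mul (fun q hq ↦ (hSprime w hw q hq).1)
      (hbig w hw).1 (he₅ _ (htx w hw)) (he₁₃ _ (htx w hw))
  have hfU (w) (hw : w ∈ I) : f w ∈ U := by
    have h0 : (0 : ℝ) < (∏ p ∈ w.1, p : ℕ) := by exact_mod_cast hm w.1 (mem_sigma.1 hw).1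
    have h1 : (0 : ℝ) < w.2 := by exact_mod_cast (hbig w hw).1.pos
    have hlo' := hlo _ (htx w hw)
    have hhi' := hhi _ (htx w hw)
    have e1 : (f w : ℝ) =
        ((5 ^ e₅ (t w) * 13 ^ e₁₃ (t w) : ℕ) : ℝ) * ((∏ p ∈ w.1, p : ℕ) * w.2) := by
      rw [hf]; push_cast; ring
    have e2 : t w * ((∏ p ∈ w.1, p : ℕ) * w.2) = a * Λ ^ 2 := div_mul_cancel₀ _ (by positivity)
    refine ⟨?_, ?_, ⟨?_, fun q hq hqd ↦ ?_⟩, ?_⟩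
    · rw [e1, ← e2]
      gcongr
    · have e3 : b * Λ ^ 2 = t w * (b / a) * ((∏ p ∈ w.1, p : ℕ) * w.2) := by
        rw [mul_right_comm, e2]; field_simp
      rw [e1, e3]
      gcongr
    · have := hm w.1 (mem_sigma.1 hw).1
      have := (hbig w hw).1.pos
      positivity
    · by_cases h : f w = 0
      · have := hm w.1 (mem_sigma.1 hw).1
        have := (hbig w hw).1.pos
        have : 0 < f w := by positivity
        omega
      have hq' : q ∈ (f w).primeFactors := Nat.mem_primeFactors.2 ⟨hq, hqd, h⟩
      rw [hpf w hw] at hq'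
      simp only [mem_union, mem_insert, mem_singleton] at hq'
      rcases hq' with hq' | rfl | rfl | rfl
      · exact (hSprime w hw q hq').2
      · rfl
      · rfl
      · exact (hbig w hw).2.1
    · rw [hpf w hw, card_union_five_thirteen (hbig w hw).2.2.2.1 (hbig w hw).2.2.1,
        (mem_powersetCard.1 (mem_filter.1 (mem_sigma.1 hw).1).1).2]
  have hinj : Set.InjOn f I := by
    rintro ⟨S, p⟩ hw ⟨S', p'⟩ hw' h
    have h1 := congrArg Nat.primeFactors h
    rw [hpf _ hw, hpf _ hw'] at h1
    obtain ⟨rfl, rfl⟩ := eq_and_eq_of_union_five_thirteen_eq (hbig _ hw).2.2.2.1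
      (hbig _ hw').2.2.2.1 (hbig _ hw).2.2.1 (hbig _ hw').2.2.1 h1
    rfl
  rw [finsum_mem_eq_finite_toFinset_sum _ hfin]
  have hsub : I.image f ⊆ hfin.toFinset := by
    intro ℓ hℓ
    obtain ⟨w, hw, rfl⟩ := mem_image.1 hℓ
    exact hfin.mem_toFinset.2 (hfU w hw)
  calc ∑ S ∈ T, 2 ^ (j + 3) * (Y S / log (B * Y S))
      ≤ ∑ S ∈ T, ∑ _p ∈ primesOneModFour (B * Y S) \ primesOneModFour (Y S), (2 : ℝ) ^ (j + 3) := by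
        refine sum_le_sum fun S hS ↦ ?_
        rw [sum_const, nsmul_eq_mul, mul_comm]
        have : (13 : ℝ) ≤ Λ / D := (le_div_iff₀ hD).2 (by linarith)
        gcongr
        exact hB _ (by linarith [hYle S hS])
    _ = ∑ _w ∈ I, (2 : ℝ) ^ (j + 3) := (sum_sigma T _ fun _ ↦ (2 : ℝ) ^ (j + 3)).symm
    _ ≤ ∑ w ∈ I, (rTwoSquares (f w) : ℝ) := by
        refine sum_le_sum fun w hw ↦ ?_
        have h1 := hfU w hw
        have := two_pow_card_primeFactors_le_rTwoSquares h1.2.2.1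
        rw [h1.2.2.2] at this
        exact_mod_cast this
    _ = ∑ ℓ ∈ I.image f, (rTwoSquares ℓ : ℝ) :=
        (sum_image (f := fun ℓ ↦ (rTwoSquares ℓ : ℝ)) hinj).symm
    _ ≤ _ := sum_le_sum_of_subset_of_nonneg hsub fun _ _ _ ↦ Nat.cast_nonneg _

lemma factorial_le_exp_one_mul_sqrt_mul_pow {n : ℕ} (hn : n ≠ 0) :
    (n.factorial : ℝ) ≤ exp 1 * √n * (n / exp 1) ^ n := by
  obtain ⟨m, rfl⟩ := Nat.exists_eq_succ_of_ne_zero hn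
  have h := Stirling.stirlingSeq'_antitone (Nat.zero_le m)
  simp only [Function.comp_apply, Nat.succ_eq_add_one, zero_add] at h ⊢
  rw [Stirling.stirlingSeq_one, Stirling.stirlingSeq, div_le_iff₀ (by positivity)] at h
  refine h.trans_eq ?_
  rw [sqrt_mul (by norm_num)]
  field_simp

lemma exp_neg_two_mul_le_one_sub {t : ℝ} (h0 : 0 ≤ t) (h : t ≤ 1 / 2) : exp (-2 * t) ≤ 1 - t := by
  have ht : 0 < 1 - t := by linarith
  rw [← le_log_iff_exp_le ht]
  refine le_trans ?_ (one_sub_inv_le_log_of_pos ht)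
  rw [← sub_nonneg]
  have : 1 - (1 - t)⁻¹ - -2 * t = t * (1 - 2 * t) / (1 - t) := by field_simp; ring
  rw [this]
  exact div_nonneg (mul_nonneg h0 (by linarith)) ht.le

lemma exp_div_sqrt_le_pow_div_factorial {β C : ℝ} (hβ : 0 < β) (hC : 0 ≤ C) :
    ∃ c L₀ : ℝ, 0 < c ∧ ∀ L, L₀ ≤ L → ∀ j : ℕ, β * L - 4 ≤ j → j ≤ β * L →
      c * (exp (β * L * (1 - log β)) / √L) ≤ (L - C) ^ j / j.factorial := by
  refine ⟨exp (-2 * C * β) * exp (-4 * |1 - log β|) / (exp 1 * √β), max (max 1 (2 * C)) (5 / β),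
    by positivity, fun L hL j hj1 hj2 ↦ ?_⟩
  simp only [max_le_iff] at hL
  obtain ⟨⟨hL1, hL2⟩, hL3⟩ := hL
  rw [div_le_iff₀ hβ] at hL3
  have hL0 : 0 < L := by linarith
  have hj0 : (0 : ℝ) < j := by linarith
  have hjn : j ≠ 0 := by rintro rfl; simp at hj0
  have h1 : L * exp (-2 * (C / L)) ≤ L - C := by
    have := exp_neg_two_mul_le_one_sub (t := C / L) (by positivity)
      ((div_le_iff₀ hL0).2 (by linarith))
    calc L * exp (-2 * (C / L)) ≤ L * (1 - C / L) := by gcongr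
      _ = L - C := by field_simp
  have h2 : L ^ j * exp (-2 * C * β) ≤ (L - C) ^ j := by
    refine le_trans ?_ (pow_le_pow_left₀ (by positivity) h1 j)
    rw [mul_pow, ← exp_nat_mul]
    refine mul_le_mul_of_nonneg_left (exp_le_exp.2 ?_) (by positivity)
    have : C * (j / L) ≤ C * β := by
      gcongr
      exact (div_le_iff₀ hL0).2 hj2
    have e : (j : ℝ) * (-2 * (C / L)) = -2 * (C * (j / L)) := by ring
    rw [e]; linarith
  have h3 : exp (j * (1 - log β)) / (exp 1 * √(β * L)) ≤ L ^ j / j.factorial := by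
    rw [div_le_div_iff₀ (by positivity) (by positivity)]
    have h4 : exp (1 - log β) * (j / exp 1) ≤ L := by
      rw [exp_sub, exp_log hβ]
      have : exp 1 / β * (j / exp 1) = j / β := by field_simp
      rw [this, div_le_iff₀ hβ]; linarith
    calc exp (j * (1 - log β)) * j.factorial
        ≤ exp (j * (1 - log β)) * (exp 1 * √j * (j / exp 1) ^ j) := by
          gcongr; exact factorial_le_exp_one_mul_sqrt_mul_pow hjn
      _ = (exp (1 - log β) * (j / exp 1)) ^ j * (exp 1 * √j) := by
          rw [exp_nat_mul, mul_pow]; ring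
      _ ≤ L ^ j * (exp 1 * √(β * L)) := by gcongr
  have h5 : exp (-4 * |1 - log β|) * exp (β * L * (1 - log β)) ≤ exp (j * (1 - log β)) := by
    rw [← exp_add]
    gcongr
    have : (β * L - j) * (1 - log β) ≤ 4 * |1 - log β| := by
      calc _ ≤ (β * L - j) * |1 - log β| :=
            mul_le_mul_of_nonneg_left (le_abs_self _) (by linarith)
        _ ≤ _ := mul_le_mul_of_nonneg_right (by linarith) (abs_nonneg _)
    linarith
  calc _ = exp (-2 * C * β) * (exp (-4 * |1 - log β|) * exp (β * L * (1 - log β)) /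
        (exp 1 * √(β * L))) := by
        rw [sqrt_mul hβ.le]; field_simp
    _ ≤ exp (-2 * C * β) * (exp (j * (1 - log β)) / (exp 1 * √(β * L))) := by gcongr
    _ ≤ exp (-2 * C * β) * (L ^ j / j.factorial) := by gcongr
    _ = L ^ j * exp (-2 * C * β) / j.factorial := by ring
    _ ≤ _ := by gcongr

lemma half_log_log_sub_le_sum_filter_inv (k : ℕ) : ∃ C : ℝ, 0 ≤ C ∧ ∀ x : ℝ, exp 1 ≤ x →
    log (log x) / 2 - C ≤ ∑ p ∈ primesOneModFour x with k < p, 1 / (p : ℝ) := by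
  obtain ⟨C, hC⟩ := half_log_log_sub_le_sum_inv
  refine ⟨|C| + (k + 1), by positivity, fun x hx ↦ ?_⟩
  have h1 := hC x hx
  rw [← sum_filter_add_sum_filter_not _ (fun p ↦ k < p)] at h1
  have h2 : ∑ p ∈ primesOneModFour x with ¬ k < p, 1 / (p : ℝ) ≤ k + 1 := by
    calc _ ≤ ∑ p ∈ range (k + 1), (1 : ℝ) := by
          refine (sum_le_sum (g := fun _ ↦ (1 : ℝ)) fun p hp ↦ ?_).trans
            (sum_le_sum_of_subset_of_nonneg (fun p hp ↦ ?_) fun _ _ _ ↦ zero_le_one)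
          · have := (mem_primesOneModFour.1 (mem_filter.1 hp).1).1.one_le
            exact div_le_one_of_le₀ (by exact_mod_cast this) (by positivity)
          · exact mem_range_succ_iff.2 (not_lt.1 (mem_filter.1 hp).2)
      _ = k + 1 := by simp
  linarith [le_abs_self C]

lemma sq_div_mul_one_div_le {B D m x M : ℝ} (hB : 1 < B) (hD : 1 ≤ D) (hm : 1 ≤ m) (hmx : m ≤ x)
    (hDx : D ≤ x) (hM : log (B * x ^ 2) ≤ M) :
    x ^ 2 / (D * M) * (1 / m) ≤ x ^ 2 / (m * D) / log (B * (x ^ 2 / (m * D))) := by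
  have hx : 0 < x := by linarith
  have hmD : 1 ≤ m * D := one_le_mul_of_one_le_of_one_le hm hD
  have hY : 1 ≤ x ^ 2 / (m * D) := by
    rw [one_le_div (by linarith), sq]
    gcongr
  have hpos : 0 < log (B * (x ^ 2 / (m * D))) := log_pos (by nlinarith)
  have hle : log (B * (x ^ 2 / (m * D))) ≤ M := by
    refine le_trans (log_le_log (by positivity) ?_) hM
    gcongr
    exact div_le_self (by positivity) hmD
  calc x ^ 2 / (D * M) * (1 / m) = x ^ 2 / (m * D) / M := by
        rw [div_mul_div_comm, mul_one, div_div]; ring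
    _ ≤ _ := by gcongr

end

theorem stmt_9 (a b β : ℝ) (ha : 0 < a) (hab : a < b) (hβ : 0 < β) :
    ∃ c Λ₀ : ℝ, 0 < c ∧ 0 < Λ₀ ∧
      ∀ Λ : ℝ, Λ₀ ≤ Λ →
        c * (Λ ^ 2 / Real.sqrt (Real.log (Real.log Λ))) *
            (Real.log Λ) ^ (β - 1 - β * Real.log β) ≤
          ∑ᶠ ℓ ∈ {ℓ : ℕ | a * Λ ^ 2 ≤ (ℓ : ℝ) ∧ (ℓ : ℝ) ≤ b * Λ ^ 2 ∧ ℓ ∈ A1 ∧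
              ℓ.primeFactors.card = ⌊β * Real.log (Real.log Λ)⌋₊},
            (rTwoSquares ℓ : ℝ) := by
  obtain ⟨B, hB1, hB⟩ := div_log_le_card_primesOneModFour_sdiff
  obtain ⟨x₀, hx₀, hx⟩ := exists_five_pow_mul_thirteen_pow_mem_Icc ((one_lt_div ha).2 hab)
  obtain ⟨C₁, -, hquarter⟩ := quarter_pow_le_sum_powersetCard_prod_le
  set A := 4 * β with hA
  set k := max 13 ⌈2 * A ^ 2⌉₊ with hk
  set R := max 2 (C₁ * A + log 4) with hR
  obtain ⟨C₂, hC₂, hsum⟩ := half_log_log_sub_le_sum_filter_inv k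
  have hR2 : 2 ≤ R := le_max_left _ _
  have hR0 : 0 < R := by linarith
  set C₃ := log R + 2 * C₂ with hC₃
  have hC₃0 : 0 ≤ C₃ := by have := log_nonneg (show 1 ≤ R by linarith); positivity
  obtain ⟨c, L₀, hc, hmain⟩ := exp_div_sqrt_le_pow_div_factorial hβ hC₃0
  set D := max 1 (x₀ * B / a) with hD
  have hD1 : 1 ≤ D := le_max_left _ _
  have hD0 : 0 < D := by linarith
  have haD : x₀ * B ≤ a * D := by
    rw [mul_comm a, ← div_le_iff₀ ha]; exact le_max_right _ _
  have hlog := tendsto_log_atTop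
  have hloglog := hlog.comp hlog
  obtain ⟨Λ₀, hΛ₀⟩ := Filter.eventually_atTop.1 ((Filter.eventually_ge_atTop (D * 13)).and <|
    (Filter.eventually_ge_atTop B).and <| (hlog.eventually_ge_atTop R).and <|
    (hlog.eventually_ge_atTop (2 * log D)).and <| (hloglog.eventually_ge_atTop L₀).and <|
    (hloglog.eventually_ge_atTop (2 * C₃)).and <| (hloglog.eventually_ge_atTop (3 / β)))
  refine ⟨2 * c / (3 * D), max 1 Λ₀, by positivity, by positivity, fun Λ hΛ ↦ ?_⟩
  obtain ⟨hΛ13, hΛB, hΛR, hΛD, hL₀, hLC, hL3⟩ := hΛ₀ Λ (le_of_max_le_right hΛ)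
  simp only [Function.comp_apply] at hL₀ hLC hL3
  have hΛ0 : 0 < Λ := by linarith
  set X := log Λ with hX
  set L := log X with hL
  have hX0 : 0 < X := by linarith
  rw [div_le_iff₀ hβ, mul_comm] at hL3
  have hL0 : 0 < L := by
    by_contra! h
    nlinarith
  set K := ⌊β * L⌋₊ with hK
  have hK3 : 3 ≤ K := Nat.le_floor (by exact_mod_cast hL3)
  obtain ⟨j, hj⟩ := Nat.exists_eq_add_of_le' hK3
  have hK1 : (K : ℝ) ≤ β * L := Nat.floor_le (by positivity)
  have hK2 : β * L < K + 1 := Nat.lt_floor_add_one _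
  have hjK : (K : ℝ) = j + 3 := by exact_mod_cast hj
  have hj1 : β * L - 4 ≤ j := by linarith
  have hj2 : j ≤ β * L := by linarith
  set y := exp (X / R) with hy
  have hlogy : log y = X / R := log_exp _
  have hye : exp 1 ≤ y := exp_le_exp.2 ((one_le_div hR0).2 hΛR)
  set Q := {p ∈ primesOneModFour y | k < p} with hQ
  have hQmem (q : ℕ) (hq : q ∈ Q) : q.Prime ∧ q % 4 = 1 ∧ 13 < q ∧ (q : ℝ) ≤ y := by
    rw [hQ, Finset.mem_filter, mem_primesOneModFour] at hq
    exact ⟨hq.1.1, hq.1.2.1, (le_max_left _ _).trans_lt hq.2, hq.1.2.2⟩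
  have hyΛ : D * y ≤ Λ := by
    rw [← exp_log hD0, ← exp_log hΛ0, hy, ← exp_add]
    refine exp_le_exp.2 ?_
    have : X / R ≤ X / 2 := by gcongr
    linarith
  set P := ∑ p ∈ Q, 1 / (p : ℝ) with hP
  have hPL : (L - C₃) / 2 ≤ P := by
    have := hsum y hye
    rw [hlogy, log_div hX0.ne' hR0.ne'] at this
    linarith
  have hP4 : L / 4 ≤ P := by linarith
  have hsq : A ^ 2 * ∑ p ∈ Q, (1 / (p : ℝ)) ^ 2 ≤ 1 := by
    have h1 := sum_one_div_sq_le (Q := Q) (k := k) fun p hp ↦ (Finset.mem_filter.1 hp).2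
    have h2 : 2 * A ^ 2 ≤ k := (Nat.le_ceil _).trans (by exact_mod_cast le_max_right _ _)
    calc _ ≤ A ^ 2 * (2 / ((k : ℝ) + 1)) := by gcongr
      _ ≤ 1 := by rw [← mul_div_assoc, div_le_one (by positivity)]; linarith
  have hq := hquarter A R y Λ Q j hye (Finset.filter_subset _ _) (by nlinarith) hsq hΛ0
    (by rw [hlogy, mul_div_cancel₀ _ hR0.ne']) (by
      rw [← le_log_iff_exp_le (by norm_num), one_div, log_inv]
      linarith [le_max_right 2 (C₁ * A + log 4)]) (by linarith)
  have hlower := sum_two_pow_mul_div_log_le_finsum (j := j) ha hD0 hx₀.le hB hx haD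
    hyΛ hΛ13 hQmem
  rw [← hj] at hlower
  refine le_trans ?_ hlower
  have hlogB : log (B * Λ ^ 2) ≤ 3 * X := by
    rw [log_mul (by linarith) (by positivity), log_pow]
    have := log_le_log (by linarith) hΛB
    push_cast
    linarith
  set T := {S ∈ Finset.powersetCard j Q | (((∏ p ∈ S, p : ℕ) : ℝ) ≤ Λ)} with hT
  have hterm (S) (hS : S ∈ T) : 2 ^ K * (Λ ^ 2 / (D * (3 * X))) * (1 / ((∏ p ∈ S, p : ℕ) : ℝ)) ≤
      2 ^ K * (Λ ^ 2 / ((∏ p ∈ S, p : ℕ) * D) / log (B * (Λ ^ 2 / ((∏ p ∈ S, p : ℕ) * D)))) := by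
    have hm : (1 : ℝ) ≤ (∏ p ∈ S, p : ℕ) := by
      exact_mod_cast Finset.prod_pos fun q hq ↦
        (hQmem q ((Finset.mem_powersetCard.1 (Finset.mem_filter.1 hS).1).1 hq)).1.pos
    rw [mul_assoc]
    exact mul_le_mul_of_nonneg_left (sq_div_mul_one_div_le hB1 hD1 hm (Finset.mem_filter.1 hS).2
      (by linarith) hlogB) (by positivity)
  refine le_trans ?_ (Finset.sum_le_sum hterm)
  rw [← Finset.mul_sum]
  have hsum' : P ^ j / (4 * j.factorial) ≤ ∑ S ∈ T, 1 / ((∏ p ∈ S, p : ℕ) : ℝ) := by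
    rw [div_le_iff₀ (by positivity)]
    linarith
  have hpow : X ^ (β - 1 - β * log β) = exp (β * L * (1 - log β)) / X := by
    have h : exp (β * L * (1 - log β) - L) = exp (β * L * (1 - log β)) / X := by
      rw [exp_sub, exp_log hX0]
    rw [rpow_def_of_pos hX0, ← hL, ← h]
    congr 1
    ring
  calc 2 * c / (3 * D) * (Λ ^ 2 / √L) * X ^ (β - 1 - β * log β)
      = 2 * Λ ^ 2 / (D * (3 * X)) * (c * (exp (β * L * (1 - log β)) / √L)) := by
        rw [hpow]; field_simp
    _ ≤ 2 * Λ ^ 2 / (D * (3 * X)) * ((2 * P) ^ j / j.factorial) := by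
        gcongr
        refine (hmain L hL₀ j hj1 hj2).trans ?_
        gcongr <;> linarith
    _ = 2 ^ K * (Λ ^ 2 / (D * (3 * X))) * (P ^ j / (4 * j.factorial)) := by
        rw [hj, mul_pow]; field_simp; ring
    _ ≤ _ := by gcongr
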